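/- arXiv:2406.02769 — 2 statements merged into one kernel-verified Lean document; each statement's English description precedes it below -/
import Mathlib

section
/- Let g ∈ ℝ^d and h ∈ ℝ^n have i.i.d. N(0,1) entries, independent of (v, θ*), let R > 0, λ > 0, κ = d/n, σ ≥ 0, and let h₀ : ℝ³ → ℝ be twice continuously differentiable with ‖∇²h₀‖ ≤ C, either uniformly bounded or equal to h₀(u,v,θ) = u², and |μ| ≤ λ/C. Consider the unconstrained problem min_{u ∈ ℝ^d} max_{0 ≤ τ ≤ R} [ (2τ‖h‖₂/√n)·√(σ² + (1/d)‖u ⊙ v − θ*‖₂²) − (2τ/√(nd)) gᵀ(u ⊙ v − θ*) − τ² + (λ/d)‖u‖₂² + (μ/d)∑_{i=1}^d h₀(u_i, v_i, θ*_i) ]. Then its minimizer u* satisfies, with probability tending to 1 as n, d → ∞ with d/n = κ fixed, ‖(1/√d)(u* ⊙ v − θ*)‖₂ ≤ C'(1 + ‖v‖_∞) for a constant C' independent of d. -/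
open MeasureTheory ProbabilityTheory Filter Topology NNReal ENNReal

noncomputable section

/-- A function `g : ℝ² → ℝ` is pseudo-Lipschitz of order 2 (PL(2)) with respect to the
Euclidean norm on ℝ². -/
def PseudoLipschitz2Pair (g : ℝ × ℝ → ℝ) : Prop :=
  ∃ C > (0 : ℝ), ∀ x y : ℝ × ℝ,
    |g x - g y| ≤
      C * (1 + Real.sqrt (x.1 ^ 2 + x.2 ^ 2) + Real.sqrt (y.1 ^ 2 + y.2 ^ 2)) *
        Real.sqrt ((x.1 - y.1) ^ 2 + (x.2 - y.2) ^ 2)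

/-- The distribution of the pair of Gaussian vectors `(g, h) ∈ ℝ^d × ℝ^n`, each with i.i.d.
`N(0,1)` entries. -/
def gaussPairMeasure (d n : ℕ) : Measure ((Fin d → ℝ) × (Fin n → ℝ)) :=
  (Measure.pi fun _ : Fin d => gaussianReal 0 1).prod
    (Measure.pi fun _ : Fin n => gaussianReal 0 1)

lemma det_bound {d n : ℕ} (hd : 0 < d) (hn : 0 < n) (σ lam R μ K L T B c : ℝ)
    (hR : 0 < R) (hc : 0 < c) (hK : 0 ≤ K) (hL : 0 ≤ L) (hT : 0 ≤ T)
    (v θ g u : Fin d → ℝ) (h : Fin n → ℝ) (h₀ : ℝ × ℝ × ℝ → ℝ)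
    (hh : ∑ i, h i ^ 2 ≤ K * n) (hg : ∑ i, g i ^ 2 ≤ L * n) (hθ : ∑ i, θ i ^ 2 ≤ T * d)
    (hlow : ∀ u : Fin d → ℝ, c * ((d : ℝ)⁻¹ * ∑ k, u k ^ 2) - B ≤
      (lam / (d : ℝ)) * ∑ k, u k ^ 2 + (μ / (d : ℝ)) * ∑ k, h₀ (u k, v k, θ k))
    (hup : (μ / (d : ℝ)) * ∑ k, h₀ (0, v k, θ k) ≤ B)
    (hmin : IsMinOn
      (fun u : Fin d → ℝ =>
        ⨆ τ : Set.Icc (0 : ℝ) R,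
          (2 * (τ : ℝ) * Real.sqrt (∑ i, h i ^ 2) / Real.sqrt n) *
              Real.sqrt (σ ^ 2 + (1 / (d : ℝ)) * ∑ k, (u k * v k - θ k) ^ 2)
            - (2 * (τ : ℝ) / Real.sqrt ((n : ℝ) * (d : ℝ))) *
              ∑ k, g k * (u k * v k - θ k)
            - (τ : ℝ) ^ 2
            + (lam / (d : ℝ)) * ∑ k, u k ^ 2
            + (μ / (d : ℝ)) * ∑ k, h₀ (u k, v k, θ k))
      Set.univ u) :
    Real.sqrt (∑ k, ((1 / Real.sqrt d) * (u k * v k - θ k)) ^ 2)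
      ≤ Real.sqrt (2 * ((2 * B + 2 * R * (√K * √(σ ^ 2 + T)) + 2 * R * (√L * √T)) / c) + 2 * T)
        * (1 + ⨆ i, |v i|) := by
  have hd' : (0 : ℝ) < d := by exact_mod_cast hd
  have hn' : (0 : ℝ) < n := by exact_mod_cast hn
  have hθd : (d : ℝ)⁻¹ * ∑ k, θ k ^ 2 ≤ T := by
    rw [inv_mul_le_iff₀ hd']; linarith
  set Q := (2 * B + 2 * R * (√K * √(σ ^ 2 + T)) + 2 * R * (√L * √T)) / c with hQ
  have hB := hlow 0
  have hne : Nonempty (Set.Icc (0 : ℝ) R) := ⟨⟨0, by simp [hR.le]⟩⟩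
  have key : (d : ℝ)⁻¹ * ∑ k, u k ^ 2 ≤ Q := by
    have h1 := isMinOn_iff.1 hmin 0 (Set.mem_univ _)
    have h2 : c * ((d : ℝ)⁻¹ * ∑ k, u k ^ 2) - B ≤ B + 2 * R * (√K * √(σ ^ 2 + T)) + 2 * R * (√L * √T) := by
      refine le_trans ?_ (h1.trans ?_)
      · refine (hlow u).trans ?_
        refine le_trans ?_ (le_ciSup (f := fun τ : Set.Icc (0 : ℝ) R => _) ?_ ⟨0, by simp [hR.le]⟩)
        · simp
        · have : IsCompact (Set.univ : Set (Set.Icc (0 : ℝ) R)) := isCompact_univ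
          rw [← Set.image_univ]
          apply this.bddAbove_image
          fun_prop
      · apply ciSup_le
        rintro ⟨τ, hτ0, hτR⟩
        simp only [Pi.zero_apply, zero_mul, zero_sub, neg_sq]
        have e1 : √(∑ i, h i ^ 2) / √n ≤ √K := by
          rw [← Real.sqrt_div (by positivity)]
          apply Real.sqrt_le_sqrt
          rw [div_le_iff₀ hn']; exact hh
        have e2 : √(σ ^ 2 + 1 / (d : ℝ) * ∑ k, θ k ^ 2) ≤ √(σ ^ 2 + T) := by
          apply Real.sqrt_le_sqrt
          rw [one_div]; linarith
        have e3 : 2 * τ * √(∑ i, h i ^ 2) / √n * √(σ ^ 2 + 1 / (d : ℝ) * ∑ k, θ k ^ 2)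
            ≤ 2 * R * (√K * √(σ ^ 2 + T)) := by
          rw [mul_div_assoc, mul_assoc]
          gcongr
        have e4 : -((∑ k, g k * (- θ k)) / √((n : ℝ) * d)) ≤ √L * √T := by
          have cs := Real.sum_mul_le_sqrt_mul_sqrt Finset.univ g θ
          simp only [mul_neg, Finset.sum_neg_distrib]
          rw [neg_div, neg_neg, div_le_iff₀ (by positivity), Real.sqrt_mul hn'.le]
          calc _ ≤ _ := cs
            _ ≤ √(L * n) * √(T * d) := by gcongr
            _ = _ := by rw [Real.sqrt_mul hL, Real.sqrt_mul hT]; ring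
        have e5 : -(2 * τ / √((n : ℝ) * d) * ∑ k, g k * (- θ k)) ≤ 2 * R * (√L * √T) := by
          calc _ = 2 * τ * (-((∑ k, g k * (- θ k)) / √((n : ℝ) * d))) := by ring
            _ ≤ 2 * τ * (√L * √T) := by gcongr
            _ ≤ _ := by gcongr
        have e6 : 0 ≤ τ ^ 2 := sq_nonneg _
        simp only [ne_eq, OfNat.ofNat_ne_zero, not_false_eq_true, zero_pow, Finset.sum_const_zero, mul_zero]
        linarith
    rw [hQ, le_div_iff₀ hc]; linarith
  have hQ0 : 0 ≤ Q := le_trans (by positivity) key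
  set V := ⨆ i, |v i|
  have hV0 : 0 ≤ V := Real.iSup_nonneg fun i => abs_nonneg _
  have hvV : ∀ i, v i ^ 2 ≤ V ^ 2 := fun i => by
    rw [← sq_abs]
    have := le_ciSup (f := fun i => |v i|) (Set.finite_range _).bddAbove i
    gcongr
  rw [show ∑ k, ((1 / Real.sqrt d) * (u k * v k - θ k)) ^ 2 = (d : ℝ)⁻¹ * ∑ k, (u k * v k - θ k) ^ 2 by
    rw [Finset.mul_sum]; refine Finset.sum_congr rfl fun k _ => ?_
    rw [mul_pow, div_pow, Real.sq_sqrt hd'.le]; simp]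
  have h3 : ∑ k, (u k * v k - θ k) ^ 2 ≤ 2 * V ^ 2 * ∑ k, u k ^ 2 + 2 * ∑ k, θ k ^ 2 := by
    rw [Finset.mul_sum, Finset.mul_sum, ← Finset.sum_add_distrib]
    refine Finset.sum_le_sum fun k _ => ?_
    nlinarith [sq_nonneg (u k * v k + θ k), mul_le_mul_of_nonneg_left (hvV k) (sq_nonneg (u k))]
  have h4 : (d : ℝ)⁻¹ * ∑ k, (u k * v k - θ k) ^ 2 ≤ (2 * Q + 2 * T) * (1 + V) ^ 2 := by
    calc _ ≤ (d : ℝ)⁻¹ * (2 * V ^ 2 * ∑ k, u k ^ 2 + 2 * ∑ k, θ k ^ 2) := by gcongr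
      _ = 2 * V ^ 2 * ((d : ℝ)⁻¹ * ∑ k, u k ^ 2) + 2 * ((d : ℝ)⁻¹ * ∑ k, θ k ^ 2) := by ring
      _ ≤ 2 * V ^ 2 * Q + 2 * T := by gcongr
      _ ≤ _ := by
        have := mul_nonneg hQ0 hV0
        have := mul_nonneg hT hV0
        have := mul_nonneg hT (sq_nonneg V)
        nlinarith
  calc _ ≤ _ := Real.sqrt_le_sqrt h4
    _ = _ := by rw [Real.sqrt_mul (by positivity), Real.sqrt_sq (by positivity)]

lemma hess_ge (C : ℝ) (hhess : ∀ x : ℝ × ℝ × ℝ, ‖iteratedFDeriv ℝ 2 (fun x : ℝ × ℝ × ℝ => x.1 ^ 2) x‖ ≤ C) :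
    2 ≤ C := by
  have h := hhess 0
  have h1 := (iteratedFDeriv ℝ 2 (fun x : ℝ × ℝ × ℝ => x.1 ^ 2) 0).le_opNorm (fun _ => ((1 : ℝ), (0 : ℝ), (0 : ℝ)))
  rw [iteratedFDeriv_two_apply] at h1
  have e : fderiv ℝ (fun x : ℝ × ℝ × ℝ => x.1 ^ 2) = fun x => (2 * x.1) • ContinuousLinearMap.fst ℝ ℝ (ℝ × ℝ) := by
    ext1 x
    have := (hasFDerivAt_fst (𝕜 := ℝ) (p := x)).pow 2
    simpa using this.fderiv
  have e2 : HasFDerivAt (fun x : ℝ × ℝ × ℝ => (2 * x.1) • ContinuousLinearMap.fst ℝ ℝ (ℝ × ℝ))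
      (((2 : ℝ) • ContinuousLinearMap.fst ℝ ℝ (ℝ × ℝ)).smulRight (ContinuousLinearMap.fst ℝ ℝ (ℝ × ℝ))) 0 :=
    (((2 : ℝ) • ContinuousLinearMap.fst ℝ ℝ (ℝ × ℝ)).smulRight
      (ContinuousLinearMap.fst ℝ ℝ (ℝ × ℝ))).hasFDerivAt
  rw [e, e2.fderiv] at h1
  simp [Prod.norm_def] at h1
  linarith

lemma gauss_conc : ∃ K : ℝ, 0 ≤ K ∧ Tendsto (fun m : ℕ => (Measure.pi fun _ : Fin m => gaussianReal 0 1)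
    {x | ¬ ∑ i, x i ^ 2 ≤ K * m}) atTop (𝓝 0) := by
  have hL : MemLp (fun x : ℝ => x ^ 2) 2 (gaussianReal 0 1) := by
    have h4 : MemLp (fun x : ℝ => x) 4 (gaussianReal 0 1) := memLp_id_gaussianReal 4
    have : Integrable (fun x : ℝ => ‖x‖ ^ 4) (gaussianReal 0 1) := by
      have := h4.integrable_norm_pow (by norm_num)
      simpa using this
    rw [memLp_two_iff_integrable_sq (by fun_prop)]
    refine this.congr (ae_of_all _ fun x => ?_)
    simp only [Real.norm_eq_abs]
    rw [← pow_mul, Even.pow_abs (by decide)]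
  set c := ∫ x, x ^ 2 ∂(gaussianReal 0 1) with hc
  set V := Var[fun x : ℝ => x ^ 2; gaussianReal 0 1] with hV
  have hc0 : 0 ≤ c := integral_nonneg fun x => sq_nonneg x
  refine ⟨c + 1, by positivity, ?_⟩
  have hb : ∀ m : ℕ, 0 < m → (Measure.pi fun _ : Fin m => gaussianReal 0 1)
      {x | ¬ ∑ i, x i ^ 2 ≤ (c + 1) * m} ≤ ENNReal.ofReal (V / m) := by
    intro m hm
    have hm' : (0 : ℝ) < m := by exact_mod_cast hm
    set P := Measure.pi fun _ : Fin m => gaussianReal 0 1 with hP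
    have hi : ∀ i : Fin m, MemLp (fun x : Fin m → ℝ => x i ^ 2) 2 P := fun i =>
      hL.comp_measurePreserving (measurePreserving_eval (fun _ : Fin m => gaussianReal 0 1) i)
    have hS : MemLp (∑ i, fun x : Fin m → ℝ => x i ^ 2) 2 P := memLp_finsetSum' _ fun i _ => hi i
    have hvar := variance_sum_pi (ι := Fin m) (μ := fun _ => gaussianReal 0 1)
      (X := fun _ x => x ^ 2) (fun _ => hL)
    have hmean : ∫ x, (∑ i, fun x : Fin m → ℝ => x i ^ 2) x ∂P = m * c := by
      simp only [Finset.sum_apply]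
      rw [integral_finsetSum _ fun i _ => (hi i).integrable (by norm_num)]
      have : ∀ i : Fin m, ∫ x, x i ^ 2 ∂P = c := fun i => by
        have := integral_map (μ := P) (φ := fun x : Fin m → ℝ => x i) (f := fun y : ℝ => y ^ 2)
          (measurable_pi_apply i).aemeasurable (by fun_prop)
        rw [← this, hP, (measurePreserving_eval (fun _ : Fin m => gaussianReal 0 1) i).map_eq]
      simp [this]
    have ch := meas_ge_le_variance_div_sq hS hm'
    rw [hvar, hmean] at ch
    refine (measure_mono ?_).trans (ch.trans (le_of_eq ?_))
    · intro x hx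
      simp only [Set.mem_ofPred_eq, not_le, Finset.sum_apply] at hx ⊢
      refine le_trans ?_ (le_abs_self _)
      linarith
    · congr 1
      simp only [Finset.sum_const, Finset.card_univ, Fintype.card_fin, nsmul_eq_mul]
      rw [← hV]
      field_simp
  have ht : Tendsto (fun m : ℕ => ENNReal.ofReal (V / m)) atTop (𝓝 0) := by
    have := ENNReal.tendsto_ofReal (tendsto_const_div_atTop_nhds_zero_nat V)
    simpa using this
  refine tendsto_of_tendsto_of_tendsto_of_le_of_le' tendsto_const_nhds ht
    (Eventually.of_forall fun _ => zero_le) ?_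
  filter_upwards [eventually_gt_atTop 0] with m hm using hb m hm

lemma pl_sq : PseudoLipschitz2Pair (fun p => p.2 ^ 2) := by
  refine ⟨1, one_pos, fun x y => ?_⟩
  have h1 : |x.2| ≤ √(x.1 ^ 2 + x.2 ^ 2) := Real.abs_le_sqrt (by nlinarith [sq_nonneg x.1])
  have h2 : |y.2| ≤ √(y.1 ^ 2 + y.2 ^ 2) := Real.abs_le_sqrt (by nlinarith [sq_nonneg y.1])
  have h3 : |x.2 - y.2| ≤ √((x.1 - y.1) ^ 2 + (x.2 - y.2) ^ 2) :=
    Real.abs_le_sqrt (by nlinarith [sq_nonneg (x.1 - y.1)])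
  have h4 := abs_add_le x.2 y.2
  simp only
  rw [sq_sub_sq, abs_mul]
  gcongr
  linarith

/-- For the auxiliary (CGMT) unconstrained problem
`min_u max_{0≤τ≤R} [(2τ‖h‖₂/√n)√(σ² + (1/d)‖u ⊙ v − θ*‖₂²) − (2τ/√(nd)) gᵀ(u ⊙ v − θ*) − τ²
  + (λ/d)‖u‖₂² + (μ/d)∑ᵢ h₀(uᵢ, vᵢ, θ*ᵢ)]`,
the minimizer `u*` satisfies, with probability tending to 1 as `n, d → ∞` with `d/n = κ`
fixed, `‖(1/√d)(u* ⊙ v − θ*)‖₂ ≤ C'(1 + ‖v‖_∞)` for a constant `C'` independent of `d`. -/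
theorem auxiliary_problem_solution_norm_bound
    (κ : ℝ) (hκ : 0 < κ) (σ : ℝ) (hσ : 0 ≤ σ) (lam : ℝ) (hlam : 0 < lam) (R : ℝ) (hR : 0 < R)
    (n d : ℕ → ℕ) (hn : Tendsto n atTop atTop) (hd : Tendsto d atTop atTop)
    (hratio : ∀ j, (d j : ℝ) / (n j : ℝ) = κ)
    (v θstar : (j : ℕ) → Fin (d j) → ℝ)
    (hvne : ∀ j i, v j i ≠ 0)
    (Pit : Measure (ℝ × ℝ)) (hPitProb : IsProbabilityMeasure Pit)
    (hW2 : ∀ g : ℝ × ℝ → ℝ, PseudoLipschitz2Pair g →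
      Tendsto (fun j => (d j : ℝ)⁻¹ * ∑ i, g (v j i, θstar j i)) atTop
        (𝓝 (∫ p, g p ∂Pit)))
    (h₀ : ℝ × ℝ × ℝ → ℝ) (C : ℝ) (hC : 0 < C)
    (hsmooth : ContDiff ℝ 2 h₀)
    (hhess : ∀ x, ‖iteratedFDeriv ℝ 2 h₀ x‖ ≤ C)
    (hshape : (∃ B : ℝ, ∀ x, |h₀ x| ≤ B) ∨ h₀ = fun x => x.1 ^ 2)
    (μ : ℝ) (hμ : |μ| ≤ lam / C)
    (ustar : (j : ℕ) → (Fin (d j) → ℝ) × (Fin (n j) → ℝ) → Fin (d j) → ℝ)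
    (hmin : ∀ j ω, IsMinOn
      (fun u : Fin (d j) → ℝ =>
        ⨆ τ : Set.Icc (0 : ℝ) R,
          (2 * (τ : ℝ) * Real.sqrt (∑ i, ω.2 i ^ 2) / Real.sqrt (n j)) *
              Real.sqrt (σ ^ 2 + (1 / (d j : ℝ)) * ∑ k, (u k * v j k - θstar j k) ^ 2)
            - (2 * (τ : ℝ) / Real.sqrt ((n j : ℝ) * (d j : ℝ))) *
              ∑ k, ω.1 k * (u k * v j k - θstar j k)
            - (τ : ℝ) ^ 2
            + (lam / (d j : ℝ)) * ∑ k, u k ^ 2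
            + (μ / (d j : ℝ)) * ∑ k, h₀ (u k, v j k, θstar j k))
      Set.univ (ustar j ω)) :
    ∃ C' > (0 : ℝ),
      Tendsto (fun j =>
        gaussPairMeasure (d j) (n j)
          {ω | Real.sqrt (∑ k, ((1 / Real.sqrt (d j)) * (ustar j ω k * v j k - θstar j k)) ^ 2)
            ≤ C' * (1 + ⨆ i, |v j i|)})
        atTop (𝓝 (1 : ℝ≥0∞)) := by
  have hpos : ∀ j, 0 < d j ∧ 0 < n j := by
    intro j
    have := hratio j
    constructor
    · rcases Nat.eq_zero_or_pos (d j) with h | h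
      · rw [h] at this; simp at this; exact absurd this hκ.ne
      · exact h
    · rcases Nat.eq_zero_or_pos (n j) with h | h
      · rw [h] at this; simp at this; exact absurd this hκ.ne
      · exact h
  obtain ⟨K, hK, hconc⟩ := gauss_conc
  -- lower bound constants
  obtain ⟨c, B, hc, hlow, hup⟩ : ∃ c B : ℝ, 0 < c ∧ (∀ j (u : Fin (d j) → ℝ),
      c * ((d j : ℝ)⁻¹ * ∑ k, u k ^ 2) - B ≤ (lam / (d j : ℝ)) * ∑ k, u k ^ 2
        + (μ / (d j : ℝ)) * ∑ k, h₀ (u k, v j k, θstar j k)) ∧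
      ∀ j, (μ / (d j : ℝ)) * ∑ k, h₀ (0, v j k, θstar j k) ≤ B := by
    rcases hshape with ⟨B, hB⟩ | hsq
    · have hbd : ∀ j (u : Fin (d j) → ℝ),
          |(μ / (d j : ℝ)) * ∑ k, h₀ (u k, v j k, θstar j k)| ≤ |μ| * B := by
        intro j u
        have hdj : (0 : ℝ) < d j := by exact_mod_cast (hpos j).1
        have : |∑ k, h₀ (u k, v j k, θstar j k)| ≤ d j * B := by
          refine (Finset.abs_sum_le_sum_abs _ _).trans ?_
          refine (Finset.sum_le_sum fun k _ => hB _).trans ?_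
          simp
        rw [abs_mul, abs_div, abs_of_pos hdj]
        calc _ ≤ |μ| / d j * (d j * B) := by gcongr
          _ = _ := by field_simp
      refine ⟨lam, |μ| * B, hlam, fun j u => ?_, fun j => ?_⟩
      · have := (abs_le.1 (hbd j u)).1
        have e : lam * ((d j : ℝ)⁻¹ * ∑ k, u k ^ 2) = lam / (d j : ℝ) * ∑ k, u k ^ 2 := by ring
        linarith
      · exact (abs_le.1 (hbd j fun _ => 0)).2
    · subst hsq
      have hC2 := hess_ge C hhess
      have hμ2 : |μ| ≤ lam / 2 := hμ.trans (by gcongr)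
      refine ⟨lam / 2, 0, by positivity, fun j u => ?_, fun j => by simp⟩
      have hm := (abs_le.1 hμ2).1
      have hs : 0 ≤ (d j : ℝ)⁻¹ * ∑ k, u k ^ 2 := by positivity
      have e : lam / (d j : ℝ) * ∑ k, u k ^ 2 + μ / (d j : ℝ) * ∑ k, u k ^ 2
        = (lam + μ) * ((d j : ℝ)⁻¹ * ∑ k, u k ^ 2) := by ring
      simp only
      rw [e, sub_zero]
      gcongr
      linarith
  set T := |∫ p : ℝ × ℝ, p.2 ^ 2 ∂Pit| + 1 with hTdef
  have hT : 0 ≤ T := by positivity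
  have hθ : ∀ᶠ j in atTop, ∑ i, θstar j i ^ 2 ≤ T * d j := by
    have h1 := hW2 _ pl_sq
    have h2 : (∫ p : ℝ × ℝ, p.2 ^ 2 ∂Pit) < T := by
      have := le_abs_self (∫ p : ℝ × ℝ, p.2 ^ 2 ∂Pit)
      linarith
    filter_upwards [h1.eventually_le_const h2] with j hj
    have hdj : (0 : ℝ) < d j := by exact_mod_cast (hpos j).1
    rw [inv_mul_le_iff₀ hdj] at hj
    linarith
  set S := Real.sqrt (2 * ((2 * B + 2 * R * (√K * √(σ ^ 2 + T)) + 2 * R * (√(K * κ) * √T)) / c) + 2 * T)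
  refine ⟨S + 1, by positivity, ?_⟩
  let G : (j : ℕ) → Set (Fin (d j) → ℝ) := fun j => {x | ¬ ∑ i, x i ^ 2 ≤ K * d j}
  let H : (j : ℕ) → Set (Fin (n j) → ℝ) := fun j => {x | ¬ ∑ i, x i ^ 2 ≤ K * n j}
  have hbad : Tendsto (fun j => (Measure.pi fun _ : Fin (d j) => gaussianReal 0 1) (G j)
      + (Measure.pi fun _ : Fin (n j) => gaussianReal 0 1) (H j)) atTop (𝓝 0) := by
    rw [← add_zero (0 : ℝ≥0∞)]
    exact (hconc.comp hd).add (hconc.comp hn)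
  have hgood : Tendsto (fun j => 1 - ((Measure.pi fun _ : Fin (d j) => gaussianReal 0 1) (G j)
      + (Measure.pi fun _ : Fin (n j) => gaussianReal 0 1) (H j))) atTop (𝓝 1) := by
    have := ENNReal.Tendsto.sub (tendsto_const_nhds (x := (1 : ℝ≥0∞))) hbad (Or.inl ENNReal.one_ne_top)
    simpa using this
  have hprob : ∀ j, IsProbabilityMeasure (gaussPairMeasure (d j) (n j)) := fun j => by
    unfold gaussPairMeasure; infer_instance
  refine tendsto_of_tendsto_of_tendsto_of_le_of_le' hgood tendsto_const_nhds ?_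
    (Eventually.of_forall fun j => prob_le_one)
  filter_upwards [hθ] with j hθj
  rw [tsub_le_iff_right]
  set A := {ω : (Fin (d j) → ℝ) × (Fin (n j) → ℝ) |
    Real.sqrt (∑ k, ((1 / Real.sqrt (d j)) * (ustar j ω k * v j k - θstar j k)) ^ 2)
            ≤ (S + 1) * (1 + ⨆ i, |v j i|)} with hA
  have hcov : (Set.univ : Set ((Fin (d j) → ℝ) × (Fin (n j) → ℝ))) ⊆
      A ∪ (G j ×ˢ Set.univ ∪ Set.univ ×ˢ H j) := by
    intro ω _
    by_cases hg : ∑ i, ω.1 i ^ 2 ≤ K * d j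
    · by_cases hh : ∑ i, ω.2 i ^ 2 ≤ K * n j
      · left
        have hg' : ∑ i, ω.1 i ^ 2 ≤ K * κ * n j := by
          have hnj : (0 : ℝ) < n j := by exact_mod_cast (hpos j).2
          have := hratio j
          rw [div_eq_iff hnj.ne'] at this
          rw [this] at hg
          linarith
        have := det_bound (hpos j).1 (hpos j).2 σ lam R μ K (K * κ) T B c hR hc hK (by positivity) hT
          (v j) (θstar j) ω.1 (ustar j ω) ω.2 h₀ hh hg' hθj (hlow j) (hup j) (hmin j ω)
        refine this.trans ?_
        have hV0 : 0 ≤ ⨆ i, |v j i| := Real.iSup_nonneg fun i => abs_nonneg _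
        gcongr
        exact le_add_of_nonneg_right zero_le_one
      · right; right; exact ⟨Set.mem_univ _, hh⟩
    · right; left; exact ⟨hg, Set.mem_univ _⟩
  calc (1 : ℝ≥0∞) = gaussPairMeasure (d j) (n j) Set.univ := measure_univ.symm
    _ ≤ _ := measure_mono hcov
    _ ≤ gaussPairMeasure (d j) (n j) A + (gaussPairMeasure (d j) (n j) (G j ×ˢ Set.univ)
        + gaussPairMeasure (d j) (n j) (Set.univ ×ˢ H j)) :=
      (measure_union_le _ _).trans (by gcongr; exact measure_union_le _ _)
    _ = _ := by
      unfold gaussPairMeasure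
      rw [Measure.prod_prod, Measure.prod_prod, measure_univ, measure_univ, mul_one, one_mul]
end
end

section
/- Fix τ > 0 and β > 0. Let g ∈ ℝ^d and h ∈ ℝ^n have i.i.d. N(0,1) entries independent of (v, θ*), and set ξ = ‖h‖₂/√n. Define f_d(τ, β) = τσ²ξ/β + τβξ − τ² + (1/d)∑_{i=1}^d [ τξθ*_i²/β − (τ/(βξ))(βg_i√κ − ξθ*_i)² ] + (1/d)∑_{i=1}^d M_{λ(·)² + μh₀(·, v_i, θ*_i)}((ξθ*_i − βg_i√κ)/(ξv_i); β/(2ξτv_i²)), and f(τ, β) = τσ²/β + τβ(1 − κ) − τ² + E[ M_{λ(·)² + μh₀(·, V, Θ)}((Θ − βG√κ)/V; β/(2τV²)) ], where the expectation is over (V, Θ) ~ Π_t and an independent G ~ N(0,1). Then, under the stated assumptions, f_d(τ, β) converges in probability to f(τ, β) as n, d → ∞ with d/n = κ fixed. -/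
open MeasureTheory ProbabilityTheory Filter Topology NNReal ENNReal

noncomputable section

/-- The Moreau envelope of `ℓ : ℝ → ℝ` with step size `s > 0`:
`M_ℓ(x; s) = inf_y [ ℓ(y) + (1/(2s))(y − x)² ]`. -/
def moreau (ℓ : ℝ → ℝ) (s x : ℝ) : ℝ :=
  ⨅ y : ℝ, (ℓ y + 1 / (2 * s) * (y - x) ^ 2)

/-- Objective after reparametrization. -/
def Jobj (L : ℝ × ℝ × ℝ → ℝ) (t a ξ v θ g y : ℝ) : ℝ :=
  L (y, v, θ) + t * ξ * (v * y - θ + a * g / ξ) ^ 2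

/-- Value function after reparametrization. -/
def FF (L : ℝ × ℝ × ℝ → ℝ) (t a ξ v θ g : ℝ) : ℝ :=
  ⨅ y : ℝ, Jobj L t a ξ v θ g y

lemma moreau_eq_FF (h₀ : ℝ × ℝ × ℝ → ℝ) (lam μ τ β κ ξ v θ g : ℝ) (hτ : 0 < τ) (hβ : 0 < β)
    (hξ : ξ ≠ 0) (hv : v ≠ 0) :
    moreau (fun u => lam * u ^ 2 + μ * h₀ (u, v, θ)) (β / (2 * ξ * τ * v ^ 2))
      ((ξ * θ - β * g * Real.sqrt κ) / (ξ * v))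
    = FF (fun x => lam * x.1 ^ 2 + μ * h₀ x) (τ / β) (β * Real.sqrt κ) ξ v θ g := by
  unfold moreau FF Jobj
  congr 1
  funext y
  simp only
  congr 1
  field_simp
  ring

section
variable {L : ℝ × ℝ × ℝ → ℝ} {t a c B : ℝ}

lemma Jobj_lower (ht : 0 < t) (hlow : ∀ y v θ, c * y ^ 2 - B ≤ L (y, v, θ))
    {ξ : ℝ} (hξ : 0 < ξ) (v θ g y : ℝ) : c * y ^ 2 - B ≤ Jobj L t a ξ v θ g y := by
  have := hlow y v θ
  have h2 : 0 ≤ t * ξ * (v * y - θ + a * g / ξ) ^ 2 := by positivity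
  unfold Jobj
  linarith

lemma Jobj_bdd (ht : 0 < t) (hc : 0 < c) (hlow : ∀ y v θ, c * y ^ 2 - B ≤ L (y, v, θ))
    {ξ : ℝ} (hξ : 0 < ξ) (v θ g : ℝ) :
    BddBelow (Set.range (Jobj L t a ξ v θ g)) := by
  refine ⟨-B, ?_⟩
  rintro _ ⟨y, rfl⟩
  have := Jobj_lower (a := a) ht hlow hξ v θ g y
  nlinarith [mul_nonneg hc.le (sq_nonneg y)]

lemma FF_lower (ht : 0 < t) (hc : 0 < c) (hlow : ∀ y v θ, c * y ^ 2 - B ≤ L (y, v, θ))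
    {ξ : ℝ} (hξ : 0 < ξ) (v θ g : ℝ) : -B ≤ FF L t a ξ v θ g := by
  refine le_ciInf fun y => ?_
  have := Jobj_lower (a := a) ht hlow hξ v θ g y
  nlinarith [mul_nonneg hc.le (sq_nonneg y)]

lemma FF_upper (ht : 0 < t) (hc : 0 < c) (hlow : ∀ y v θ, c * y ^ 2 - B ≤ L (y, v, θ))
    (hup : ∀ v θ, L (0, v, θ) ≤ B)
    {ξ : ℝ} (hξ : 0 < ξ) (v θ g : ℝ) :
    FF L t a ξ v θ g ≤ B + t * ξ * (-θ + a * g / ξ) ^ 2 := by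
  refine (ciInf_le (Jobj_bdd ht hc hlow hξ v θ g) 0).trans ?_
  have := hup v θ
  unfold Jobj
  simp only [mul_zero, zero_sub]
  linarith

/-- crude bound at `ξ = 1`. -/
lemma FF_one_abs (ht : 0 < t) (hc : 0 < c) (hlow : ∀ y v θ, c * y ^ 2 - B ≤ L (y, v, θ))
    (hup : ∀ v θ, L (0, v, θ) ≤ B) (hB : 0 ≤ B) {T : ℝ} {θ : ℝ} (hθ : |θ| ≤ T) (v g : ℝ) :
    |FF L t a 1 v θ g| ≤ (B + 2 * t * T ^ 2 + 2 * t * a ^ 2) * (1 + g ^ 2) := by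
  have h1 := FF_lower (a := a) ht hc hlow one_pos v θ g
  have h2 := FF_upper (a := a) ht hc hlow hup one_pos v θ g
  have h3 : θ ^ 2 ≤ T ^ 2 := by
    rw [← sq_abs θ]; exact pow_le_pow_left₀ (abs_nonneg _) hθ 2
  have h4 : (-θ + a * g / 1) ^ 2 ≤ 2 * T ^ 2 + 2 * a ^ 2 * g ^ 2 := by
    nlinarith [sq_nonneg (θ + a * g)]
  have h5 : t * 1 * (-θ + a * g / 1) ^ 2 ≤ t * (2 * T ^ 2 + 2 * a ^ 2 * g ^ 2) := by
    rw [mul_one]; exact mul_le_mul_of_nonneg_left h4 ht.le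
  have p1 : 0 ≤ B * g ^ 2 := by positivity
  have p2 : 0 ≤ t * T ^ 2 * g ^ 2 := by positivity
  have p3 : 0 ≤ t * T ^ 2 := by positivity
  have p4 : 0 ≤ t * a ^ 2 * g ^ 2 := by positivity
  have p5 : 0 ≤ t * a ^ 2 := by positivity
  rw [abs_le]
  constructor <;> nlinarith

lemma Jobj_one_continuous (hL : Continuous L) :
    Continuous (↿(fun (x : ℝ × ℝ × ℝ) y => Jobj L t a 1 x.1 x.2.1 x.2.2 y)) := by
  unfold Jobj
  simp only [div_one]
  have : Continuous fun p : (ℝ × ℝ × ℝ) × ℝ => 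
     L (p.2, p.1.1, p.1.2.1) + t * 1 * (p.1.1 * p.2 - p.1.2.1 + a * p.1.2.2) ^ 2 := by
    fun_prop
  exact this

lemma FF_one_continuous (hL : Continuous L) (ht : 0 < t) (hc : 0 < c)
    (hlow : ∀ y v θ, c * y ^ 2 - B ≤ L (y, v, θ))
    (hup : ∀ v θ, L (0, v, θ) ≤ B) :
    Continuous (fun x : ℝ × ℝ × ℝ => FF L t a 1 x.1 x.2.1 x.2.2) := by
  rw [continuous_iff_continuousAt]
  intro x₀
  set Q : ℝ × ℝ × ℝ → ℝ := fun x => B + t * 1 * (-x.2.1 + a * x.2.2 / 1) ^ 2 with hQ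
  have hQc : Continuous Q := by simp only [hQ, div_one]; fun_prop
  have hev : ∀ᶠ x in 𝓝 x₀, Q x < Q x₀ + 1 :=
    hQc.continuousAt.eventually_lt_const (by linarith)
  set R : ℝ := Real.sqrt ((Q x₀ + 1 + B) / c) with hR
  have hcomp : IsCompact (Set.Icc (-R) R) := isCompact_Icc
  have hcont := hcomp.continuous_sInf (Jobj_one_continuous (L := L) (t := t) (a := a) hL)
  refine hcont.continuousAt.congr ?_
  filter_upwards [hev] with x hx
  obtain ⟨v, θ, g⟩ := x
  simp only
  have hR0 : 0 ≤ R := Real.sqrt_nonneg _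
  have hbdd := Jobj_bdd (a := a) ht hc hlow one_pos v θ g
  have hbdd' : BddBelow ((fun y => Jobj L t a 1 v θ g y) '' Set.Icc (-R) R) :=
    hbdd.mono (Set.image_subset_range _ _)
  have h0 : Jobj L t a 1 v θ g 0 ≤ Q (v, θ, g) := by
    have := hup v θ
    simp only [hQ, Jobj, mul_zero, zero_sub]
    linarith
  apply le_antisymm
  · refine le_ciInf fun y => ?_
    by_cases hy : y ∈ Set.Icc (-R) R
    · exact csInf_le hbdd' ⟨y, hy, rfl⟩
    · have h1 : sInf ((fun y => Jobj L t a 1 v θ g y) '' Set.Icc (-R) R) ≤ Q (v, θ, g) :=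
        (csInf_le hbdd' ⟨0, ⟨by linarith, hR0⟩, rfl⟩).trans h0
      have h2 : R < |y| := by
        by_contra hcon
        exact hy (abs_le.1 (not_lt.1 hcon))
      have h3 : (Q x₀ + 1 + B) / c < y ^ 2 := by
        rw [← sq_abs y]
        exact (Real.sqrt_lt' (hR0.trans_lt h2)).1 h2
      have h4 := Jobj_lower (a := a) ht hlow one_pos v θ g y
      rw [div_lt_iff₀ hc] at h3
      linarith
  · refine le_csInf ⟨_, 0, ⟨by linarith, hR0⟩, rfl⟩ ?_
    rintro _ ⟨y, _, rfl⟩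
    exact ciInf_le hbdd y

/-- Lipschitz in `ξ` near one. -/
lemma FF_xi (ht : 0 < t) (hc : 0 < c)
    (hlow : ∀ y v θ, c * y ^ 2 - B ≤ L (y, v, θ))
    (hup : ∀ v θ, L (0, v, θ) ≤ B) {T θ ξ ζ : ℝ} (hθ : |θ| ≤ T)
    (h1 : 1 / 2 ≤ ξ) (h2 : ξ ≤ 2) (h3 : 1 / 2 ≤ ζ) (h4 : ζ ≤ 2) (v g : ℝ) :
    FF L t a ζ v θ g ≤ FF L t a ξ v θ g
      + |ζ - ξ| * (8 * B + 16 * t * T ^ 2 + 28 * t * a ^ 2 * g ^ 2) := by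
  have hξ : 0 < ξ := by linarith
  have hζ : 0 < ζ := by linarith
  set δ := |ζ - ξ| with hδ
  have hδ0 : 0 ≤ δ := abs_nonneg _
  have hq : ∀ y, Jobj L t a ζ v θ g y ≤ Jobj L t a ξ v θ g y
      + δ * (4 * (Jobj L t a ξ v θ g y + B) + 12 * t * (a * g) ^ 2) := by
    intro y
    have hl := hlow y v θ
    have hcy : 0 ≤ c * y ^ 2 := by positivity
    unfold Jobj
    set A := v * y - θ with hA
    set b := a * g with hb
    set l := L (y, v, θ)
    have e1 : ∀ x : ℝ, x ≠ 0 → t * x * (A + b / x) ^ 2 = t * (x * A ^ 2 + 2 * A * b + b ^ 2 / x) := by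
      intro x hx; field_simp; ring
    have hAA : A ^ 2 ≤ 4 * (ξ * (A + b / ξ) ^ 2) + 8 * b ^ 2 := by
      have e : A = (A + b / ξ) - b / ξ := by ring
      have e2 : (b / ξ) ^ 2 ≤ 4 * b ^ 2 := by
        rw [div_pow, div_le_iff₀ (by positivity)]
        have : 1 / 4 ≤ ξ ^ 2 := by nlinarith
        nlinarith [sq_nonneg b]
      have e3 : A ^ 2 ≤ 2 * (A + b / ξ) ^ 2 + 2 * (b / ξ) ^ 2 := by
        nlinarith [sq_nonneg (A + b / ξ + b / ξ)]
      nlinarith [sq_nonneg (A + b / ξ)]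
    have hinv : b ^ 2 / ζ - b ^ 2 / ξ ≤ δ * (4 * b ^ 2) := by
      have : b ^ 2 / ζ - b ^ 2 / ξ = (ξ - ζ) * (b ^ 2 / (ζ * ξ)) := by field_simp
      rw [this]
      have h5 : ξ - ζ ≤ δ := by rw [hδ, abs_sub_comm]; exact le_abs_self _
      have h6 : b ^ 2 / (ζ * ξ) ≤ 4 * b ^ 2 := by
        rw [div_le_iff₀ (by positivity)]
        have : 1 / 4 ≤ ζ * ξ := by nlinarith
        nlinarith [sq_nonneg b]
      have h7 : 0 ≤ b ^ 2 / (ζ * ξ) := by positivity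
      calc _ ≤ δ * (b ^ 2 / (ζ * ξ)) := mul_le_mul_of_nonneg_right h5 h7
        _ ≤ _ := mul_le_mul_of_nonneg_left h6 hδ0
    have hlin : (ζ - ξ) * A ^ 2 ≤ δ * (4 * (ξ * (A + b / ξ) ^ 2) + 8 * b ^ 2) :=
      (mul_le_mul_of_nonneg_right (le_abs_self _) (sq_nonneg A)).trans
        (mul_le_mul_of_nonneg_left hAA hδ0)
    have hsum : (ζ * A ^ 2 + 2 * A * b + b ^ 2 / ζ) - (ξ * A ^ 2 + 2 * A * b + b ^ 2 / ξ)
        ≤ δ * (4 * (ξ * (A + b / ξ) ^ 2) + 12 * b ^ 2) := by linarith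
    have hsum' := mul_le_mul_of_nonneg_left hsum ht.le
    have hle : δ * (4 * (t * ξ * (A + b / ξ) ^ 2) + 12 * t * b ^ 2) ≤
        δ * (4 * (l + t * ξ * (A + b / ξ) ^ 2 + B) + 12 * t * b ^ 2) := by
      apply mul_le_mul_of_nonneg_left _ hδ0
      linarith
    have f1 := e1 ζ hζ.ne'
    have f2 := e1 ξ hξ.ne'
    rw [← sub_nonneg] at hsum' hle ⊢
    linear_combination hsum' + hle + f1 - f2
  have hinf : (FF L t a ζ v θ g - δ * (4 * B + 12 * t * (a * g) ^ 2)) / (1 + 4 * δ)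
      ≤ FF L t a ξ v θ g := by
    refine le_ciInf fun y => ?_
    rw [div_le_iff₀ (by positivity)]
    have := (ciInf_le (Jobj_bdd (a := a) ht hc hlow hζ v θ g) y).trans (hq y)
    unfold FF
    linarith
  rw [div_le_iff₀ (by positivity)] at hinf
  have hup2 := FF_upper (a := a) ht hc hlow hup hξ v θ g
  have hθ2 : θ ^ 2 ≤ T ^ 2 := by
    rw [← sq_abs θ]; exact pow_le_pow_left₀ (abs_nonneg _) hθ 2
  have hz : ξ * (-θ + a * g / ξ) ^ 2 ≤ 4 * T ^ 2 + 4 * (a * g) ^ 2 := by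
    have : ξ * (-θ + a * g / ξ) ^ 2 ≤ ξ * (2 * θ ^ 2 + 2 * (a * g / ξ) ^ 2) :=
      mul_le_mul_of_nonneg_left (by nlinarith [sq_nonneg (θ + a * g / ξ)]) hξ.le
    have e : ξ * (2 * θ ^ 2 + 2 * (a * g / ξ) ^ 2) = 2 * ξ * θ ^ 2 + 2 * (a * g) ^ 2 / ξ := by
      field_simp
    have e2 : 2 * (a * g) ^ 2 / ξ ≤ 4 * (a * g) ^ 2 := by
      rw [div_le_iff₀ hξ]; nlinarith [sq_nonneg (a * g)]
    nlinarith [sq_nonneg θ]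
  have hz' := mul_le_mul_of_nonneg_left hz ht.le
  have hF : 4 * FF L t a ξ v θ g ≤ 4 * B + 16 * t * T ^ 2 + 16 * t * (a * g) ^ 2 := by linarith
  have := mul_le_mul_of_nonneg_left hF hδ0
  linarith
end

lemma gauss_memLp_one_add_sq : MemLp (fun x : ℝ => 1 + x ^ 2) 2 (gaussianReal 0 1) := by
  have h4 : MemLp (id : ℝ → ℝ) 4 (gaussianReal 0 1) := by
    exact_mod_cast memLp_id_gaussianReal (μ := 0) (v := 1) 4
  have hsq : MemLp (fun x : ℝ => x * x) 2 (gaussianReal 0 1) := by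
    have hh : ENNReal.HolderTriple 4 4 2 := ⟨by
      rw [← two_mul, show (4 : ℝ≥0∞) = 2 * 2 by norm_num,
        ENNReal.mul_inv (by simp) (by simp), ← mul_assoc,
        ENNReal.mul_inv_cancel (by simp) (by simp), one_mul]⟩
    exact MemLp.mul (f := id) (φ := id) h4 h4
  have h1 : MemLp (fun _ : ℝ => (1 : ℝ)) 2 (gaussianReal 0 1) := memLp_const 1
  have := h1.add hsq
  refine this.congr_norm (by fun_prop) ?_
  filter_upwards with x
  simp [sq]

lemma gauss_integral_sq : ∫ x : ℝ, x ^ 2 ∂(gaussianReal 0 1) = 1 := by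
  have h := variance_id_gaussianReal (μ := 0) (v := 1)
  rw [variance_of_integral_eq_zero (by fun_prop) (by simp)] at h
  simpa using h

/-- The constant in Chebyshev's inequality. -/
def chebK : ℝ := ∫ x : ℝ, (1 + x ^ 2) ^ 2 ∂(gaussianReal 0 1)

lemma memLp_of_growth {f : ℝ → ℝ} {K : ℝ} (hf : Measurable f)
    (hb : ∀ x, |f x| ≤ K * (1 + x ^ 2)) : MemLp f 2 (gaussianReal 0 1) := by
  refine (gauss_memLp_one_add_sq.const_mul K).mono hf.aestronglyMeasurable ?_
  filter_upwards with x
  rw [Real.norm_eq_abs, Real.norm_eq_abs]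
  exact (hb x).trans (le_abs_self _)

lemma variance_of_growth {f : ℝ → ℝ} {K : ℝ} (hf : Measurable f)
    (hb : ∀ x, |f x| ≤ K * (1 + x ^ 2)) : Var[f; gaussianReal 0 1] ≤ K ^ 2 * chebK := by
  refine (variance_le_expectation_sq hf.aestronglyMeasurable).trans ?_
  unfold chebK
  rw [← integral_const_mul]
  refine integral_mono (memLp_of_growth hf hb).integrable_sq
    (gauss_memLp_one_add_sq.integrable_sq.const_mul _) ?_
  intro x
  simp only [Pi.pow_apply]
  rw [← mul_pow, ← sq_abs (f x)]
  exact pow_le_pow_left₀ (abs_nonneg _) (hb x) 2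

lemma cheb_pi (d : ℕ) (hd : 0 < d) (f : Fin d → ℝ → ℝ) (K : ℝ) (hf : ∀ i, Measurable (f i))
    (hb : ∀ i x, |f i x| ≤ K * (1 + x ^ 2)) {δ : ℝ} (hδ : 0 < δ) :
    (Measure.pi fun _ : Fin d => gaussianReal 0 1)
      {ω | δ ≤ |(d : ℝ)⁻¹ * ∑ i, f i (ω i) - (d : ℝ)⁻¹ * ∑ i, ∫ x, f i x ∂(gaussianReal 0 1)|}
      ≤ ENNReal.ofReal (K ^ 2 * chebK / δ ^ 2 * (d : ℝ)⁻¹) := by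
  set P := (Measure.pi fun _ : Fin d => gaussianReal 0 1) with hP
  have hd' : (0 : ℝ) < d := by exact_mod_cast hd
  have hm : ∀ i, MemLp (f i) 2 (gaussianReal 0 1) := fun i => memLp_of_growth (hf i) (hb i)
  have hm' : ∀ i, MemLp (fun ω : Fin d → ℝ => f i (ω i)) 2 P := fun i =>
    (hm i).comp_measurePreserving (measurePreserving_eval (fun _ : Fin d => gaussianReal 0 1) i)
  have hS : MemLp (∑ i, fun ω : Fin d → ℝ => f i (ω i)) 2 P := memLp_finsetSum' _ fun i _ => hm' i
  have hmean : ∫ ω, (∑ i, fun ω : Fin d → ℝ => f i (ω i)) ω ∂P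
      = ∑ i, ∫ x, f i x ∂(gaussianReal 0 1) := by
    simp only [Finset.sum_apply]
    rw [integral_finsetSum _ fun i _ => (hm' i).integrable (by norm_num)]
    refine Finset.sum_congr rfl fun i _ => ?_
    exact integral_comp_eval (μ := fun _ : Fin d => gaussianReal 0 1) (i := i) (f := f i) (hf i).aestronglyMeasurable
  have hvar : Var[∑ i, fun ω : Fin d → ℝ => f i (ω i); P] ≤ d * (K ^ 2 * chebK) := by
    rw [hP, variance_sum_pi hm]
    refine (Finset.sum_le_sum fun i _ => variance_of_growth (hf i) (hb i)).trans ?_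
    simp
  have hc := meas_ge_le_variance_div_sq hS (c := d * δ) (by positivity)
  rw [hmean] at hc
  have hset : {ω : Fin d → ℝ | δ ≤ |(d : ℝ)⁻¹ * ∑ i, f i (ω i)
      - (d : ℝ)⁻¹ * ∑ i, ∫ x, f i x ∂(gaussianReal 0 1)|} ⊆
      {ω | d * δ ≤ |(∑ i, fun ω : Fin d → ℝ => f i (ω i)) ω
        - ∑ i, ∫ x, f i x ∂(gaussianReal 0 1)|} := by
    intro ω hω
    simp only [Set.mem_ofPred_eq, Finset.sum_apply] at hω ⊢
    rw [← mul_sub, abs_mul, abs_of_pos (inv_pos.2 hd'), inv_mul_eq_div, le_div_iff₀ hd'] at hω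
    linarith
  refine (measure_mono hset).trans (hc.trans (ENNReal.ofReal_le_ofReal ?_))
  rw [div_le_iff₀ (by positivity)]
  refine hvar.trans (le_of_eq ?_)
  field_simp

lemma cheb_tendsto (d : ℕ → ℕ) (hd : Tendsto d atTop atTop) (hdpos : ∀ j, 0 < d j)
    (f : (j : ℕ) → Fin (d j) → ℝ → ℝ) (K : ℝ)
    (hf : ∀ j i, Measurable (f j i))
    (hb : ∀ j i x, |f j i x| ≤ K * (1 + x ^ 2)) {δ : ℝ} (hδ : 0 < δ) :
    Tendsto (fun j => (Measure.pi fun _ : Fin (d j) => gaussianReal 0 1)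
      {ω | δ ≤ |(d j : ℝ)⁻¹ * ∑ i, f j i (ω i)
        - (d j : ℝ)⁻¹ * ∑ i, ∫ x, f j i x ∂(gaussianReal 0 1)|}) atTop (𝓝 0) := by
  have h1 : Tendsto (fun j => ENNReal.ofReal (K ^ 2 * chebK / δ ^ 2 * (d j : ℝ)⁻¹)) atTop (𝓝 0) := by
    have : Tendsto (fun j => K ^ 2 * chebK / δ ^ 2 * (d j : ℝ)⁻¹) atTop (𝓝 0) := by
      have := (tendsto_inv_atTop_nhds_zero_nat (𝕜 := ℝ)).comp hd
      simpa using this.const_mul (K ^ 2 * chebK / δ ^ 2)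
    simpa using ENNReal.tendsto_ofReal this
  exact tendsto_of_tendsto_of_tendsto_of_le_of_le tendsto_const_nhds h1 (fun _ => zero_le)
    fun j => cheb_pi (d j) (hdpos j) (f j) K (hf j) (hb j) hδ

/-- Weak convergence from PL(2) convergence. -/
lemma weak_conv (d : ℕ → ℕ) (hdpos : ∀ j, 0 < d j)
    (v θstar : (j : ℕ) → Fin (d j) → ℝ)
    (Pit : Measure (ℝ × ℝ)) (hPitProb : IsProbabilityMeasure Pit)
    (hW2 : ∀ g : ℝ × ℝ → ℝ, PseudoLipschitz2Pair g →
      Tendsto (fun j => (d j : ℝ)⁻¹ * ∑ i, g (v j i, θstar j i)) atTop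
        (𝓝 (∫ p, g p ∂Pit)))
    (Φ : ℝ × ℝ → ℝ) (hΦ : Continuous Φ) (K : ℝ) (hK : ∀ p, |Φ p| ≤ K) :
    Tendsto (fun j => (d j : ℝ)⁻¹ * ∑ i, Φ (v j i, θstar j i)) atTop
        (𝓝 (∫ p, Φ p ∂Pit)) := by
  let E : ℕ → Measure (ℝ × ℝ) := fun j =>
    ENNReal.ofReal (d j : ℝ)⁻¹ • ∑ i, Measure.dirac (v j i, θstar j i)
  have hEp : ∀ j, IsProbabilityMeasure (E j) := by
    intro j
    constructor
    have hd' : (0 : ℝ) < d j := by exact_mod_cast hdpos j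
    simp only [E, Measure.smul_apply, Measure.finsetSum_apply, measure_univ, Finset.sum_const,
      Finset.card_univ, Fintype.card_fin, smul_eq_mul, nsmul_eq_mul, mul_one]
    rw [ENNReal.ofReal_inv_of_pos hd', ENNReal.ofReal_natCast]
    exact ENNReal.inv_mul_cancel (by exact_mod_cast (hdpos j).ne') (by simp)
  have hEint : ∀ (g : ℝ × ℝ → ℝ) j, ∫ p, g p ∂(E j) = (d j : ℝ)⁻¹ * ∑ i, g (v j i, θstar j i) := by
    intro g j
    simp only [E]
    rw [integral_smul_measure, integral_finsetSum_measure]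
    · simp
    · intro i _
      exact integrable_dirac (by simp)
  let PE : ℕ → ProbabilityMeasure (ℝ × ℝ) := fun j => ⟨E j, hEp j⟩
  let PP : ProbabilityMeasure (ℝ × ℝ) := ⟨Pit, hPitProb⟩
  have hconv : Tendsto PE atTop (𝓝 PP) := by
    rw [tendsto_iff_forall_lipschitz_integral_tendsto]
    rintro f - ⟨M, hM⟩
    simp only [PE, PP, ProbabilityMeasure.coe_mk, hEint]
    refine hW2 f ⟨M + 1, by positivity, fun x y => ?_⟩
    have h1 := hM.dist_le_mul x y
    rw [Real.dist_eq] at h1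
    have h2 : dist x y ≤ Real.sqrt ((x.1 - y.1) ^ 2 + (x.2 - y.2) ^ 2) := by
      rw [Prod.dist_eq, Real.dist_eq, Real.dist_eq]
      refine max_le ?_ ?_
      · exact Real.abs_le_sqrt (by nlinarith [sq_nonneg (x.2 - y.2)])
      · exact Real.abs_le_sqrt (by nlinarith [sq_nonneg (x.1 - y.1)])
    have hs1 := Real.sqrt_nonneg (x.1 ^ 2 + x.2 ^ 2)
    have hs2 := Real.sqrt_nonneg (y.1 ^ 2 + y.2 ^ 2)
    have hM0 : (0 : ℝ) ≤ M := M.2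
    have hone : (M : ℝ) ≤ (M + 1) * (1 + Real.sqrt (x.1 ^ 2 + x.2 ^ 2)
        + Real.sqrt (y.1 ^ 2 + y.2 ^ 2)) := by nlinarith
    calc |f x - f y| ≤ M * dist x y := h1
      _ ≤ _ := mul_le_mul hone h2 dist_nonneg (by positivity)
  rw [ProbabilityMeasure.tendsto_iff_forall_integral_tendsto] at hconv
  have := hconv (BoundedContinuousFunction.ofNormedAddCommGroup Φ hΦ K
    (fun p => by simpa using hK p))
  simpa [PE, PP, hEint] using this

lemma theta_supp (d : ℕ → ℕ) (hdpos : ∀ j, 0 < d j)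
    (v θstar : (j : ℕ) → Fin (d j) → ℝ)
    (Pit : Measure (ℝ × ℝ)) (hPitProb : IsProbabilityMeasure Pit)
    (hW2 : ∀ g : ℝ × ℝ → ℝ, PseudoLipschitz2Pair g →
      Tendsto (fun j => (d j : ℝ)⁻¹ * ∑ i, g (v j i, θstar j i)) atTop
        (𝓝 (∫ p, g p ∂Pit)))
    (T : ℝ) (hT : ∀ j i, |θstar j i| ≤ T) : ∀ᵐ p ∂Pit, |p.2| ≤ T := by
  set Φ : ℝ × ℝ → ℝ := fun p => min (max (|p.2| - T) 0) 1 with hΦ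
  have hc : Continuous Φ := by fun_prop
  have h0 : ∀ p, 0 ≤ Φ p := fun p => le_min (le_max_right _ _) zero_le_one
  have h1 : ∀ p, |Φ p| ≤ 1 := fun p => by
    rw [abs_of_nonneg (h0 p)]; exact min_le_right _ _
  have hlim := weak_conv d hdpos v θstar Pit hPitProb hW2 Φ hc 1 h1
  have hz : ∀ j, (d j : ℝ)⁻¹ * ∑ i, Φ (v j i, θstar j i) = 0 := by
    intro j
    rw [Finset.sum_eq_zero, mul_zero]
    intro i _
    have := hT j i
    simp only [hΦ]
    rw [max_eq_right (by linarith)]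
    simp
  simp only [hz] at hlim
  have hintz : ∫ p, Φ p ∂Pit = 0 := tendsto_nhds_unique hlim tendsto_const_nhds
  have hi : Integrable Φ Pit := by
    refine Integrable.of_bound hc.aestronglyMeasurable 1 ?_
    filter_upwards with p using h1 p
  rw [integral_eq_zero_iff_of_nonneg h0 hi] at hintz
  filter_upwards [hintz] with p hp
  by_contra hcon
  have : 0 < Φ p := lt_min (lt_max_of_lt_left (by linarith [not_le.1 hcon])) one_pos
  rw [hp] at this
  simp at this

lemma shape_bounds (lam : ℝ) (hlam : 0 < lam) (h₀ : ℝ × ℝ × ℝ → ℝ) (C : ℝ) (hC : 0 < C)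
    (hhess : ∀ x, ‖iteratedFDeriv ℝ 2 h₀ x‖ ≤ C)
    (hshape : (∃ B : ℝ, ∀ x, |h₀ x| ≤ B) ∨ h₀ = fun x => x.1 ^ 2)
    (μ : ℝ) (hμ : |μ| ≤ lam / C) :
    ∃ c B : ℝ, 0 < c ∧ 0 ≤ B ∧
      (∀ y v θ, c * y ^ 2 - B ≤ (fun x : ℝ × ℝ × ℝ => lam * x.1 ^ 2 + μ * h₀ x) (y, v, θ)) ∧
      (∀ v θ, (fun x : ℝ × ℝ × ℝ => lam * x.1 ^ 2 + μ * h₀ x) (0, v, θ) ≤ B) := by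
  rcases hshape with ⟨B, hB⟩ | rfl
  · have hB0 : 0 ≤ B := (abs_nonneg _).trans (hB 0)
    have hm : ∀ x, |μ * h₀ x| ≤ |μ| * B := fun x => by
      rw [abs_mul]; exact mul_le_mul_of_nonneg_left (hB x) (abs_nonneg _)
    refine ⟨lam, |μ| * B, hlam, by positivity, fun y v θ => ?_, fun v θ => ?_⟩
    · have := (abs_le.1 (hm (y, v, θ))).1
      simp only
      linarith
    · have := (abs_le.1 (hm (0, v, θ))).2
      simp only
      linarith
  · have hC2 : 2 ≤ C := by
      set f : ℝ × ℝ × ℝ → ℝ := fun x => x.1 ^ 2 with hf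
      have hfd : fderiv ℝ f = fun x => (2 * x.1) • ContinuousLinearMap.fst ℝ ℝ (ℝ × ℝ) := by
        funext x
        have : HasFDerivAt f ((2 * x.1) • ContinuousLinearMap.fst ℝ ℝ (ℝ × ℝ)) x := by
          have h := (hasFDerivAt_fst (𝕜 := ℝ) (p := x)).pow 2
          simpa [hf] using h
        exact this.fderiv
      have hfd2 : fderiv ℝ (fderiv ℝ f) 0 ((1 : ℝ), ((0 : ℝ), (0 : ℝ))) ((1 : ℝ), ((0 : ℝ), (0 : ℝ))) = 2 := by
        rw [hfd]
        have h : HasFDerivAt (fun x : ℝ × ℝ × ℝ => (2 * x.1) • ContinuousLinearMap.fst ℝ ℝ (ℝ × ℝ))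
            (((2 : ℝ) • ContinuousLinearMap.fst ℝ ℝ (ℝ × ℝ)).smulRight
              (ContinuousLinearMap.fst ℝ ℝ (ℝ × ℝ))) 0 := by
          have hl := (((2 : ℝ) • ContinuousLinearMap.fst ℝ ℝ (ℝ × ℝ)).smulRight
              (ContinuousLinearMap.fst ℝ ℝ (ℝ × ℝ))).hasFDerivAt (x := (0 : ℝ × ℝ × ℝ))
          exact hl
        rw [h.fderiv]
        simp
      have h := (iteratedFDeriv ℝ 2 f 0).le_opNorm (fun _ => ((1 : ℝ), ((0 : ℝ), (0 : ℝ))))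
      rw [iteratedFDeriv_two_apply, hfd2] at h
      have h2 := hhess 0
      simp [Prod.norm_def] at h
      linarith
    have hml : |μ| ≤ lam / 2 := hμ.trans (div_le_div_of_nonneg_left hlam.le two_pos hC2)
    have := (abs_le.1 hml).1
    refine ⟨lam / 2, 0, by positivity, le_rfl, fun y v θ => ?_, fun v θ => by simp⟩
    simp only
    nlinarith [sq_nonneg y]

lemma sum_reduce (d : ℕ) (hd : 0 < d) (τ β κ ξ : ℝ) (hβ : β ≠ 0) (hξ : ξ ≠ 0) (hκ : 0 ≤ κ)
    (g θ : Fin d → ℝ) :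
    (1 / (d : ℝ)) * ∑ i, (τ * ξ * θ i ^ 2 / β
        - τ / (β * ξ) * (β * g i * Real.sqrt κ - ξ * θ i) ^ 2)
    = - (τ * β * κ / ξ) * ((d : ℝ)⁻¹ * ∑ i, g i ^ 2)
      + 2 * τ * Real.sqrt κ * ((d : ℝ)⁻¹ * ∑ i, θ i * g i) := by
  have hs : Real.sqrt κ ^ 2 = κ := Real.sq_sqrt hκ
  have : ∀ i, (τ * ξ * θ i ^ 2 / β
        - τ / (β * ξ) * (β * g i * Real.sqrt κ - ξ * θ i) ^ 2)
      = - (τ * β * κ / ξ) * g i ^ 2 + 2 * τ * Real.sqrt κ * (θ i * g i) := by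
    intro i
    have e : κ = Real.sqrt κ ^ 2 := hs.symm
    generalize Real.sqrt κ = s at *
    subst e
    field_simp
    ring
  simp only [this]
  rw [Finset.sum_add_distrib, ← Finset.mul_sum, ← Finset.mul_sum]
  ring

lemma final_det (τ β κ σ ξ Sg Th D Mf m I δ K F : ℝ) (hτ : 0 < τ) (hβ : 0 < β) (hκ : 0 < κ)
    (hK : 0 ≤ K) (hδ : δ ≤ 1 / 2) (hξ0 : 0 ≤ ξ) (h1 : |ξ ^ 2 - 1| < δ) (h2 : |Sg - 1| < δ)
    (h3 : |Th| < δ) (h4 : |Mf - m| < δ) (h5 : |m - I| < δ)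
    (hD : D = - (τ * β * κ / ξ) * Sg + 2 * τ * Real.sqrt κ * Th)
    (hF : |F - Mf| ≤ |ξ - 1| * (K * (1 + Sg))) :
    |(τ * σ ^ 2 * ξ / β + τ * β * ξ - τ ^ 2 + D + F)
      - (τ * σ ^ 2 / β + τ * β * (1 - κ) - τ ^ 2 + I)|
    ≤ δ * (τ * σ ^ 2 / β + τ * β + 4 * (τ * β * κ) + 2 * τ * Real.sqrt κ + K * 3 + 2) := by
  have hx : |ξ - 1| ≤ δ := by
    have e : ξ ^ 2 - 1 = (ξ - 1) * (ξ + 1) := by ring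
    rw [e, abs_mul, abs_of_pos (show 0 < ξ + 1 by linarith)] at h1
    nlinarith [abs_nonneg (ξ - 1)]
  have hδ0 : 0 ≤ δ := (abs_nonneg _).trans hx
  have hx' := abs_le.1 hx
  have hξ : 1 / 2 ≤ ξ := by linarith
  have hs' := abs_lt.1 h2
  have b1 : |(τ * σ ^ 2 / β) * (ξ - 1)| ≤ δ * (τ * σ ^ 2 / β) := by
    rw [abs_mul, abs_of_nonneg (by positivity), mul_comm]
    exact mul_le_mul_of_nonneg_right hx (by positivity)
  have b2 : |(τ * β) * (ξ - 1)| ≤ δ * (τ * β) := by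
    rw [abs_mul, abs_of_nonneg (by positivity), mul_comm]
    exact mul_le_mul_of_nonneg_right hx (by positivity)
  have b3 : |(τ * β * κ) * (1 - Sg / ξ)| ≤ δ * (4 * (τ * β * κ)) := by
    have : |1 - Sg / ξ| ≤ 4 * δ := by
      have hpos : 0 < ξ := by linarith
      have e : 1 - Sg / ξ = (ξ - Sg) / ξ := by field_simp
      rw [e, abs_div, abs_of_pos hpos, div_le_iff₀ hpos, abs_le]
      constructor <;> nlinarith
    rw [abs_mul, abs_of_nonneg (show 0 ≤ τ * β * κ by positivity)]
    nlinarith [mul_le_mul_of_nonneg_left this (show 0 ≤ τ * β * κ by positivity)]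
  have b4 : |2 * τ * Real.sqrt κ * Th| ≤ δ * (2 * τ * Real.sqrt κ) := by
    rw [abs_mul, abs_of_nonneg (show 0 ≤ 2 * τ * Real.sqrt κ by positivity), mul_comm]
    exact mul_le_mul_of_nonneg_right h3.le (by positivity)
  have b5 : |F - Mf| ≤ δ * (K * 3) := by
    refine hF.trans (mul_le_mul hx ?_ ?_ hδ0)
    · exact mul_le_mul_of_nonneg_left (by linarith) hK
    · exact mul_nonneg hK (by linarith)
  have e : (τ * σ ^ 2 * ξ / β + τ * β * ξ - τ ^ 2 + D + F)
      - (τ * σ ^ 2 / β + τ * β * (1 - κ) - τ ^ 2 + I)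
      = (τ * σ ^ 2 / β) * (ξ - 1) + (τ * β) * (ξ - 1) + (τ * β * κ) * (1 - Sg / ξ)
        + 2 * τ * Real.sqrt κ * Th + (F - Mf) + (Mf - m) + (m - I) := by
    rw [hD]; ring
  rw [e]
  rw [abs_le] at *
  rw [abs_lt] at h4 h5
  constructor <;> linarith [b1.1, b1.2]

lemma abs_sub_one_lt {ξ δ : ℝ} (hξ0 : 0 ≤ ξ) (c1 : |ξ ^ 2 - 1| < δ) : |ξ - 1| < δ := by
  have e : ξ ^ 2 - 1 = (ξ - 1) * (ξ + 1) := by ring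
  rw [e, abs_mul, abs_of_pos (show 0 < ξ + 1 by linarith)] at c1
  nlinarith [abs_nonneg (ξ - 1)]

lemma gauss_integral_lin (r : ℝ) : ∫ x : ℝ, r * x ∂(gaussianReal 0 1) = 0 := by
  rw [integral_const_mul, integral_id_gaussianReal, mul_zero]

set_option maxHeartbeats 1600000

/-- Fix `τ, β > 0`. With `ξ = ‖h‖₂/√n` for an i.i.d. Gaussian vector `h ∈ ℝ^n`
and `g ∈ ℝ^d` i.i.d. Gaussian, the random scalarized objective
`f_d(τ, β) = τσ²ξ/β + τβξ − τ² + (1/d)∑ᵢ[τξθ*ᵢ²/β − (τ/(βξ))(βgᵢ√κ − ξθ*ᵢ)²]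
  + (1/d)∑ᵢ M_{λ(·)² + μh₀(·, vᵢ, θ*ᵢ)}((ξθ*ᵢ − βgᵢ√κ)/(ξvᵢ); β/(2ξτvᵢ²))`
converges in probability, as `n, d → ∞` with `d/n = κ` fixed, to
`f(τ, β) = τσ²/β + τβ(1 − κ) − τ² + E[M_{λ(·)² + μh₀(·, V, Θ)}((Θ − βG√κ)/V; β/(2τV²))]`,
the expectation being over `(V, Θ) ~ Π_t` and an independent `G ~ N(0,1)`. -/
theorem scalarized_objective_converges_in_probability
    (κ : ℝ) (hκ : 0 < κ) (σ : ℝ) (hσ : 0 ≤ σ) (lam : ℝ) (hlam : 0 < lam)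
    (τ β : ℝ) (hτ : 0 < τ) (hβ : 0 < β)
    (n d : ℕ → ℕ) (hn : Tendsto n atTop atTop) (hd : Tendsto d atTop atTop)
    (hratio : ∀ j, (d j : ℝ) / (n j : ℝ) = κ)
    (v θstar : (j : ℕ) → Fin (d j) → ℝ)
    (hvne : ∀ j i, v j i ≠ 0)
    (Pit : Measure (ℝ × ℝ)) (hPitProb : IsProbabilityMeasure Pit)
    (hW2 : ∀ g : ℝ × ℝ → ℝ, PseudoLipschitz2Pair g →
      Tendsto (fun j => (d j : ℝ)⁻¹ * ∑ i, g (v j i, θstar j i)) atTop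
        (𝓝 (∫ p, g p ∂Pit)))
    (hVne : ∀ᵐ p ∂Pit, p.1 ≠ 0)
    (hθbdd : ∃ B : ℝ, ∀ j i, |θstar j i| ≤ B)
    (h₀ : ℝ × ℝ × ℝ → ℝ) (C : ℝ) (hC : 0 < C)
    (hsmooth : ContDiff ℝ 2 h₀)
    (hhess : ∀ x, ‖iteratedFDeriv ℝ 2 h₀ x‖ ≤ C)
    (hshape : (∃ B : ℝ, ∀ x, |h₀ x| ≤ B) ∨ h₀ = fun x => x.1 ^ 2)
    (μ : ℝ) (hμ : |μ| ≤ lam / C) :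
    ∀ ε > (0 : ℝ),
      Tendsto (fun j =>
        gaussPairMeasure (d j) (n j)
          {ω | ε ≤
            |(let ξ := Real.sqrt (∑ i, ω.2 i ^ 2) / Real.sqrt (n j);
              τ * σ ^ 2 * ξ / β + τ * β * ξ - τ ^ 2
                + (1 / (d j : ℝ)) * ∑ i,
                    (τ * ξ * θstar j i ^ 2 / β
                      - τ / (β * ξ) * (β * ω.1 i * Real.sqrt κ - ξ * θstar j i) ^ 2)
                + (1 / (d j : ℝ)) * ∑ i,
                    moreau (fun u => lam * u ^ 2 + μ * h₀ (u, v j i, θstar j i))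
                      (β / (2 * ξ * τ * v j i ^ 2))
                      ((ξ * θstar j i - β * ω.1 i * Real.sqrt κ) / (ξ * v j i)))
              - (τ * σ ^ 2 / β + τ * β * (1 - κ) - τ ^ 2
                + ∫ p, moreau (fun u => lam * u ^ 2 + μ * h₀ (u, p.1.1, p.1.2))
                    (β / (2 * τ * p.1.1 ^ 2))
                    ((p.1.2 - β * p.2 * Real.sqrt κ) / p.1.1)
                    ∂(Pit.prod (gaussianReal 0 1)))|})
        atTop (𝓝 (0 : ℝ≥0∞)) := by
  have hdn : ∀ j, 0 < d j ∧ 0 < n j := by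
    intro j
    have h := hratio j
    constructor
    · rcases Nat.eq_zero_or_pos (d j) with h0 | h0
      · rw [h0] at h; simp at h; linarith
      · exact h0
    · rcases Nat.eq_zero_or_pos (n j) with h0 | h0
      · rw [h0] at h; simp at h; linarith
      · exact h0
  obtain ⟨T, hT⟩ := hθbdd
  have hT0 : 0 ≤ T := (abs_nonneg _).trans (hT 0 ⟨0, (hdn 0).1⟩)
  obtain ⟨c, B, hc, hB, hlow, hup⟩ := shape_bounds lam hlam h₀ C hC hhess hshape μ hμ
  set L : ℝ × ℝ × ℝ → ℝ := fun x => lam * x.1 ^ 2 + μ * h₀ x with hLdef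
  have hL : Continuous L := by
    have := hsmooth.continuous
    fun_prop
  set t := τ / β with ht_def
  have ht : 0 < t := by positivity
  set a := β * Real.sqrt κ with ha_def
  set clip : ℝ → ℝ := fun θ => max (-T) (min θ T) with hclip
  have hclipc : Continuous clip := by fun_prop
  have hclipb : ∀ θ, |clip θ| ≤ T := fun θ =>
    abs_le.2 ⟨le_max_left _ _, max_le (by linarith) (min_le_right _ _)⟩
  have hclipe : ∀ θ, |θ| ≤ T → clip θ = θ := fun θ h => by
    simp only [hclip]
    rw [min_eq_left (abs_le.1 h).2, max_eq_right (abs_le.1 h).1]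
  set Fc : ℝ × ℝ × ℝ → ℝ := fun x => FF L t a 1 x.1 (clip x.2.1) x.2.2 with hFc
  have hFcc : Continuous Fc := by
    have h := FF_one_continuous (a := a) hL ht hc hlow hup
    exact h.comp (f := fun x : ℝ × ℝ × ℝ => (x.1, clip x.2.1, x.2.2)) (by fun_prop)
  set K₁ := B + 2 * t * T ^ 2 + 2 * t * a ^ 2 with hK₁
  have hFcb : ∀ v θ g, |Fc (v, θ, g)| ≤ K₁ * (1 + g ^ 2) := fun v θ g =>
    FF_one_abs ht hc hlow hup hB (hclipb θ) v g
  have hgi : Integrable (fun x : ℝ => K₁ * (1 + x ^ 2)) (gaussianReal 0 1) :=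
    (gauss_memLp_one_add_sq.integrable (by norm_num)).const_mul _
  set Φ : ℝ × ℝ → ℝ := fun p => ∫ x, Fc (p.1, p.2, x) ∂(gaussianReal 0 1) with hΦ
  have hΦc : Continuous Φ := by
    refine continuous_of_dominated (bound := fun x : ℝ => K₁ * (1 + x ^ 2)) ?_ ?_ hgi ?_
    · intro p
      exact (hFcc.comp (by fun_prop : Continuous fun x : ℝ => (p.1, p.2, x))).aestronglyMeasurable
    · intro p
      filter_upwards with x using hFcb p.1 p.2 x
    · filter_upwards with x
      exact hFcc.comp (by fun_prop : Continuous fun p : ℝ × ℝ => (p.1, p.2, x))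
  have hΦb : ∀ p, |Φ p| ≤ ∫ x, K₁ * (1 + x ^ 2) ∂(gaussianReal 0 1) := fun p =>
    norm_integral_le_of_norm_le (f := fun x => Fc (p.1, p.2, x)) hgi
      (by filter_upwards with x using hFcb p.1 p.2 x)
  have hmlim := weak_conv d (fun j => (hdn j).1) v θstar Pit hPitProb hW2 Φ hΦc _ hΦb
  have hsupp := theta_supp d (fun j => (hdn j).1) v θstar Pit hPitProb hW2 T hT
  -- identify the limit integral
  have hI : ∫ p, moreau (fun u => lam * u ^ 2 + μ * h₀ (u, p.1.1, p.1.2))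
                    (β / (2 * τ * p.1.1 ^ 2))
                    ((p.1.2 - β * p.2 * Real.sqrt κ) / p.1.1)
                    ∂(Pit.prod (gaussianReal 0 1)) = ∫ p, Φ p ∂Pit := by
    have hae : ∀ᵐ p ∂(Pit.prod (gaussianReal 0 1)), p.1.1 ≠ 0 ∧ |p.1.2| ≤ T :=
      Measure.quasiMeasurePreserving_fst.ae (hVne.and hsupp)
    have hcongr : ∫ p, moreau (fun u => lam * u ^ 2 + μ * h₀ (u, p.1.1, p.1.2))
                    (β / (2 * τ * p.1.1 ^ 2))
                    ((p.1.2 - β * p.2 * Real.sqrt κ) / p.1.1)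
                    ∂(Pit.prod (gaussianReal 0 1))
        = ∫ p, Fc (p.1.1, p.1.2, p.2) ∂(Pit.prod (gaussianReal 0 1)) := by
      refine integral_congr_ae ?_
      filter_upwards [hae] with p hp
      have h := moreau_eq_FF h₀ lam μ τ β κ 1 p.1.1 p.1.2 p.2 hτ hβ one_ne_zero hp.1
      simp only [mul_one, one_mul] at h
      rw [h]
      simp only [hFc]
      rw [hclipe _ hp.2]
    rw [hcongr]
    have hmeas : Continuous fun p : (ℝ × ℝ) × ℝ => Fc (p.1.1, p.1.2, p.2) :=
      hFcc.comp (by fun_prop)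
    rw [integral_prod]
    refine Integrable.mono' (g := fun p : (ℝ × ℝ) × ℝ => K₁ * (1 + p.2 ^ 2)) ?_
      hmeas.aestronglyMeasurable ?_
    · exact hgi.comp_snd Pit
    · filter_upwards with p using hFcb p.1.1 p.1.2 p.2
  intro ε hε
  rw [hI]
  set I := ∫ p, Φ p ∂Pit with hIdef
  set K₂ := 8 * B + 16 * t * T ^ 2 + 28 * t * a ^ 2 with hK₂
  have hK₂0 : 0 ≤ K₂ := by positivity
  set W := τ * σ ^ 2 / β + τ * β + 4 * (τ * β * κ) + 2 * τ * Real.sqrt κ + K₂ * 3 + 2 with hW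
  have hW0 : 0 < W := by positivity
  set δ := min (1 / 2) (ε / (2 * W)) with hδdef
  have hδ : 0 < δ := by positivity
  have hδ2 : δ ≤ 1 / 2 := min_le_left _ _
  have hδW : δ * W < ε := by
    have : δ ≤ ε / (2 * W) := min_le_right _ _
    rw [le_div_iff₀ (by positivity)] at this
    nlinarith
  -- bad events
  set A1 : (j : ℕ) → Set (Fin (n j) → ℝ) := fun j =>
    {ω | δ ≤ |(n j : ℝ)⁻¹ * ∑ i, (ω i) ^ 2
        - (n j : ℝ)⁻¹ * ∑ _i : Fin (n j), ∫ x : ℝ, x ^ 2 ∂(gaussianReal 0 1)|} with hA1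
  set A2 : (j : ℕ) → Set (Fin (d j) → ℝ) := fun j =>
    {ω | δ ≤ |(d j : ℝ)⁻¹ * ∑ i, (ω i) ^ 2
        - (d j : ℝ)⁻¹ * ∑ _i : Fin (d j), ∫ x : ℝ, x ^ 2 ∂(gaussianReal 0 1)|} with hA2
  set A3 : (j : ℕ) → Set (Fin (d j) → ℝ) := fun j =>
    {ω | δ ≤ |(d j : ℝ)⁻¹ * ∑ i, θstar j i * ω i
        - (d j : ℝ)⁻¹ * ∑ i, ∫ x : ℝ, θstar j i * x ∂(gaussianReal 0 1)|} with hA3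
  set A4 : (j : ℕ) → Set (Fin (d j) → ℝ) := fun j =>
    {ω | δ ≤ |(d j : ℝ)⁻¹ * ∑ i, Fc (v j i, θstar j i, ω i)
        - (d j : ℝ)⁻¹ * ∑ i, ∫ x : ℝ, Fc (v j i, θstar j i, x) ∂(gaussianReal 0 1)|} with hA4
  have t1 : Tendsto (fun j => (Measure.pi fun _ : Fin (n j) => gaussianReal 0 1) (A1 j)) atTop
      (𝓝 0) :=
    cheb_tendsto n hn (fun j => (hdn j).2) (fun _ _ x => x ^ 2) 1 (fun _ _ => by fun_prop)
      (fun _ _ x => by rw [abs_of_nonneg (sq_nonneg x)]; linarith) hδ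
  have t2 : Tendsto (fun j => (Measure.pi fun _ : Fin (d j) => gaussianReal 0 1) (A2 j)) atTop
      (𝓝 0) :=
    cheb_tendsto d hd (fun j => (hdn j).1) (fun _ _ x => x ^ 2) 1 (fun _ _ => by fun_prop)
      (fun _ _ x => by rw [abs_of_nonneg (sq_nonneg x)]; linarith) hδ
  have t3 : Tendsto (fun j => (Measure.pi fun _ : Fin (d j) => gaussianReal 0 1) (A3 j)) atTop
      (𝓝 0) :=
    cheb_tendsto d hd (fun j => (hdn j).1) (fun j i x => θstar j i * x) T (fun _ _ => by fun_prop)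
      (fun j i x => by
        rw [abs_mul]
        refine mul_le_mul (hT j i) ?_ (abs_nonneg _) hT0
        rw [← sq_abs x]
        nlinarith [sq_nonneg (|x| - 1)]) hδ
  have t4 : Tendsto (fun j => (Measure.pi fun _ : Fin (d j) => gaussianReal 0 1) (A4 j)) atTop
      (𝓝 0) :=
    cheb_tendsto d hd (fun j => (hdn j).1) (fun j i x => Fc (v j i, θstar j i, x)) K₁
      (fun j i => (hFcc.comp (by fun_prop : Continuous fun x : ℝ => (v j i, θstar j i, x))).measurable)
      (fun j i x => hFcb _ _ x) hδ
  have tsum := ((t1.add t2).add t3).add t4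
  simp only [add_zero] at tsum
  refine tendsto_of_tendsto_of_tendsto_of_le_of_le' tendsto_const_nhds tsum
    (Eventually.of_forall fun _ => zero_le) ?_
  have hm_ev : ∀ᶠ j in atTop, |(d j : ℝ)⁻¹ * ∑ i, Φ (v j i, θstar j i) - I| < δ := by
    have := (Metric.tendsto_nhds.1 hmlim) δ hδ
    simpa [Real.dist_eq] using this
  filter_upwards [hm_ev] with j hmj
  have hdpos : (0 : ℝ) < d j := by exact_mod_cast (hdn j).1
  have hnpos : (0 : ℝ) < n j := by exact_mod_cast (hdn j).2
  have hsub : {ω : (Fin (d j) → ℝ) × (Fin (n j) → ℝ) | ε ≤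
            |(let ξ := Real.sqrt (∑ i, ω.2 i ^ 2) / Real.sqrt (n j);
              τ * σ ^ 2 * ξ / β + τ * β * ξ - τ ^ 2
                + (1 / (d j : ℝ)) * ∑ i,
                    (τ * ξ * θstar j i ^ 2 / β
                      - τ / (β * ξ) * (β * ω.1 i * Real.sqrt κ - ξ * θstar j i) ^ 2)
                + (1 / (d j : ℝ)) * ∑ i,
                    moreau (fun u => lam * u ^ 2 + μ * h₀ (u, v j i, θstar j i))
                      (β / (2 * ξ * τ * v j i ^ 2))
                      ((ξ * θstar j i - β * ω.1 i * Real.sqrt κ) / (ξ * v j i)))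
              - (τ * σ ^ 2 / β + τ * β * (1 - κ) - τ ^ 2 + I)|} ⊆
      (((Set.univ ×ˢ A1 j) ∪ (A2 j ×ˢ Set.univ)) ∪ (A3 j ×ˢ Set.univ)) ∪ (A4 j ×ˢ Set.univ) := by
    rintro ⟨g, h⟩ hω
    by_contra hcon
    simp only [Set.mem_union, Set.mem_prod, Set.mem_univ, true_and, and_true, not_or] at hcon
    obtain ⟨⟨⟨c1, c2⟩, c3⟩, c4⟩ := hcon
    simp only [hA1, hA2, hA3, hA4, Set.mem_ofPred_eq, not_le, gauss_integral_sq,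
      gauss_integral_lin, mul_zero, Finset.sum_const_zero, sub_zero,
      Finset.sum_const, Finset.card_univ, Fintype.card_fin, nsmul_eq_mul, mul_one,
      inv_mul_cancel₀ hdpos.ne', inv_mul_cancel₀ hnpos.ne'] at c1 c2 c3 c4
    rw [Set.mem_ofPred_eq] at hω
    revert hω
    simp only
    set ξ := Real.sqrt (∑ i, h i ^ 2) / Real.sqrt (n j) with hξdef
    have hξ0 : 0 ≤ ξ := by positivity
    have hξsq : ξ ^ 2 = (n j : ℝ)⁻¹ * ∑ i, h i ^ 2 := by
      rw [hξdef, div_pow, Real.sq_sqrt (Finset.sum_nonneg fun i _ => sq_nonneg _),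
        Real.sq_sqrt hnpos.le]
      field_simp
    rw [← hξsq] at c1
    have hx1 : |ξ - 1| < δ := abs_sub_one_lt hξ0 c1
    have hx1' := abs_lt.1 hx1
    have hξh : 1 / 2 ≤ ξ := by linarith
    have hξ2 : ξ ≤ 2 := by linarith
    have hξne : ξ ≠ 0 := by linarith
    refine not_le.2 ?_
    refine lt_of_le_of_lt (final_det τ β κ σ ξ ((d j : ℝ)⁻¹ * ∑ i, g i ^ 2)
      ((d j : ℝ)⁻¹ * ∑ i, θstar j i * g i) _
      ((d j : ℝ)⁻¹ * ∑ i, Fc (v j i, θstar j i, g i))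
      ((d j : ℝ)⁻¹ * ∑ i, Φ (v j i, θstar j i)) I δ K₂ _ hτ hβ hκ hK₂0 hδ2 hξ0 c1 c2 c3 c4 hmj
      (sum_reduce (d j) (hdn j).1 τ β κ ξ hβ.ne' hξne hκ.le g (θstar j)) ?_) hδW
    have hterm : ∀ i, |moreau (fun u => lam * u ^ 2 + μ * h₀ (u, v j i, θstar j i))
                      (β / (2 * ξ * τ * v j i ^ 2))
                      ((ξ * θstar j i - β * g i * Real.sqrt κ) / (ξ * v j i))
          - Fc (v j i, θstar j i, g i)| ≤ |ξ - 1| * (K₂ * (1 + g i ^ 2)) := by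
      intro i
      rw [moreau_eq_FF h₀ lam μ τ β κ ξ (v j i) (θstar j i) (g i) hτ hβ hξne (hvne j i)]
      simp only [hFc]
      rw [hclipe _ (hT j i)]
      have u1 := FF_xi (a := a) ht hc hlow hup (hT j i) hξh hξ2
        (show (1 / 2 : ℝ) ≤ 1 by norm_num) (by norm_num) (v j i) (g i)
      have u2 := FF_xi (a := a) ht hc hlow hup (hT j i)
        (show (1 / 2 : ℝ) ≤ 1 by norm_num) (by norm_num) hξh hξ2 (v j i) (g i)
      rw [abs_sub_comm] at u1
      have u3 : |ξ - 1| * (8 * B + 16 * t * T ^ 2 + 28 * t * a ^ 2 * g i ^ 2)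
          ≤ |ξ - 1| * (K₂ * (1 + g i ^ 2)) := by
        refine mul_le_mul_of_nonneg_left ?_ (abs_nonneg _)
        have q1 : 0 ≤ B * g i ^ 2 := by positivity
        have q2 : 0 ≤ t * T ^ 2 * g i ^ 2 := by positivity
        have q3 : 0 ≤ t * a ^ 2 := by positivity
        rw [hK₂]
        linarith
      rw [abs_le]
      constructor <;> linarith
    rw [one_div, ← mul_sub, ← Finset.sum_sub_distrib, abs_mul, abs_of_pos (inv_pos.2 hdpos)]
    calc _ ≤ (d j : ℝ)⁻¹ * ∑ i, |ξ - 1| * (K₂ * (1 + g i ^ 2)) :=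
          mul_le_mul_of_nonneg_left
            ((Finset.abs_sum_le_sum_abs _ _).trans (Finset.sum_le_sum fun i _ => hterm i))
            (inv_pos.2 hdpos).le
      _ = _ := by
          rw [← Finset.mul_sum, ← Finset.mul_sum, Finset.sum_add_distrib]
          simp only [Finset.sum_const, Finset.card_univ, Fintype.card_fin, nsmul_eq_mul, mul_one]
          field_simp
  refine (measure_mono hsub).trans ?_
  unfold gaussPairMeasure
  refine (measure_union_le _ _).trans (add_le_add ((measure_union_le _ _).trans
    (add_le_add ((measure_union_le _ _).trans (add_le_add ?_ ?_)) ?_)) ?_) <;>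
  · rw [Measure.prod_prod]
    simp
end
end
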